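/- Let g be a nondegenerate symmetric bilinear form on ℝ⁴ with matrix (g_{ab}) and A a linear form; write g(y,y) = Σ g_{ab}y^a y^b and A(y) = Σ A_a y^a. Define the Randers Lagrangian L(y) = (√(−g(y,y)) + A(y))² on the open set {y : g(y,y) < 0}, and let g^L(y) have entries g^L_{ab}(y) = (1/2)∂²L/∂y^a∂y^b(y). Then for every y with g(y,y) < 0, writing G = g(y,y) and a = A(y): det(g^L(y)) = det(g_{ab}) · [ 1 + (5a²/G²)(a² − 2G) + (a/(−G)^{5/2})·((a² − 5G)² − 20G²) ]. -/

import Mathlib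

noncomputable section

/-- The quadratic form `g(y,y) = Σ g_{ab} y^a y^b` of a 4×4 matrix. -/
def quadForm (g : Matrix (Fin 4) (Fin 4) ℝ) (y : Fin 4 → ℝ) : ℝ :=
  ∑ a, ∑ b, g a b * y a * y b

/-- The linear form `A(y) = Σ A_a y^a`. -/
def linForm (A : Fin 4 → ℝ) (y : Fin 4 → ℝ) : ℝ := ∑ a, A a * y a

/-- The L-metric: the matrix `g^L_{ab}(y) = (1/2) ∂²L/∂y^a∂y^b (y)`. -/
def Lmetric (L : (Fin 4 → ℝ) → ℝ) (y : Fin 4 → ℝ) : Matrix (Fin 4) (Fin 4) ℝ :=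
  Matrix.of fun a b =>
    (1 / 2) * fderiv ℝ (fun z => fderiv ℝ L z (Pi.single b 1)) y (Pi.single a 1)

section Helpers

/-- the linear form as a continuous linear map -/
def linCLM (A : Fin 4 → ℝ) : (Fin 4 → ℝ) →L[ℝ] ℝ :=
  ∑ a, A a • ContinuousLinearMap.proj (R := ℝ) (φ := fun _ : Fin 4 => ℝ) a

lemma linCLM_apply (A z : Fin 4 → ℝ) : linCLM A z = linForm A z := by
  simp [linCLM, linForm]

lemma linForm_single (A : Fin 4 → ℝ) (b : Fin 4) : linForm A (Pi.single b 1) = A b := by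
  simp [linForm, Pi.single_apply]

lemma hasFDerivAt_linForm (A z : Fin 4 → ℝ) : HasFDerivAt (linForm A) (linCLM A) z := by
  have h : linForm A = fun z => linCLM A z := by
    funext z; rw [linCLM_apply]
  rw [h]; exact (linCLM A).hasFDerivAt

lemma quadForm_eq (g : Matrix (Fin 4) (Fin 4) ℝ) (z : Fin 4 → ℝ) :
    quadForm g z = ∑ a, linForm (g a) z * z a := by
  simp only [quadForm, linForm, Finset.sum_mul]
  refine Finset.sum_congr rfl fun a _ => Finset.sum_congr rfl fun b _ => by ring

lemma hasFDerivAt_quadForm (g : Matrix (Fin 4) (Fin 4) ℝ) (hgs : g.IsSymm) (z : Fin 4 → ℝ) :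
    HasFDerivAt (quadForm g) ((2 : ℝ) • linCLM (fun i => linForm (g i) z)) z := by
  have h : quadForm g = fun z => ∑ a, linForm (g a) z * z a := by
    funext z; exact quadForm_eq g z
  rw [h]
  have h1 := HasFDerivAt.fun_sum (u := Finset.univ) (fun (a : Fin 4) _ =>
    (hasFDerivAt_linForm (g a) z).mul (hasFDerivAt_apply (𝕜 := ℝ) a z))
  refine h1.congr_fderiv ?_
  ext w
  have hs : ∀ i j, g i j = g j i := fun i j => hgs.apply j i
  simp [linCLM_apply, linForm, Fin.sum_univ_four]
  rw [hs 1 0, hs 2 0, hs 3 0, hs 2 1, hs 3 1, hs 3 2]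
  ring

lemma hasFDerivAt_s (g : Matrix (Fin 4) (Fin 4) ℝ) (hgs : g.IsSymm) (z : Fin 4 → ℝ)
    (hz : quadForm g z < 0) :
    HasFDerivAt (fun z => Real.sqrt (-(quadForm g z)))
      ((-(1 / Real.sqrt (-(quadForm g z)))) • linCLM (fun i => linForm (g i) z)) z := by
  have h := (hasFDerivAt_quadForm g hgs z).neg.sqrt (by simp; linarith)
  refine h.congr_fderiv ?_
  ext w
  simp
  ring

lemma fderiv_L (g : Matrix (Fin 4) (Fin 4) ℝ) (hgs : g.IsSymm) (A : Fin 4 → ℝ)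
    (L : (Fin 4 → ℝ) → ℝ)
    (hLdef : ∀ y : Fin 4 → ℝ, quadForm g y < 0 →
      L y = (Real.sqrt (-(quadForm g y)) + linForm A y) ^ 2)
    (z : Fin 4 → ℝ) (hz : quadForm g z < 0) (b : Fin 4) :
    fderiv ℝ L z (Pi.single b 1) = 2 * (Real.sqrt (-(quadForm g z)) + linForm A z) *
      (A b - linForm (g b) z * (Real.sqrt (-(quadForm g z)))⁻¹) := by
  have hev : L =ᶠ[nhds z] fun y => (Real.sqrt (-(quadForm g y)) + linForm A y) ^ 2 := by
    have := (hasFDerivAt_quadForm g hgs z).continuousAt.eventually_lt_const hz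
    filter_upwards [this] with y hy using hLdef y hy
  rw [hev.fderiv_eq]
  have h := ((hasFDerivAt_s g hgs z hz).add (hasFDerivAt_linForm A z)).pow 2
  have h' := h.fderiv
  simp only [Pi.add_apply] at h'
  rw [h']
  simp [linCLM_apply, linForm_single]
  ring

lemma Lmetric_eq (g : Matrix (Fin 4) (Fin 4) ℝ) (hgs : g.IsSymm) (A : Fin 4 → ℝ)
    (L : (Fin 4 → ℝ) → ℝ)
    (hLdef : ∀ y : Fin 4 → ℝ, quadForm g y < 0 →
      L y = (Real.sqrt (-(quadForm g y)) + linForm A y) ^ 2)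
    (z : Fin 4 → ℝ) (hz : quadForm g z < 0) (s : ℝ) (hs : s = Real.sqrt (-(quadForm g z)))
    (a b : Fin 4) :
    Lmetric L z a b = (A a - linForm (g a) z / s) * (A b - linForm (g b) z / s)
      + (s + linForm A z) * (- g a b / s - linForm (g a) z * linForm (g b) z / s ^ 3) := by
  have hev : (fun z => fderiv ℝ L z (Pi.single b 1)) =ᶠ[nhds z] fun z =>
      2 * (Real.sqrt (-(quadForm g z)) + linForm A z) *
      (A b - linForm (g b) z * (Real.sqrt (-(quadForm g z)))⁻¹) := by
    have := (hasFDerivAt_quadForm g hgs z).continuousAt.eventually_lt_const hz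
    filter_upwards [this] with y hy using fderiv_L g hgs A L hLdef y hy b
  have hpos : 0 < Real.sqrt (-(quadForm g z)) := Real.sqrt_pos.2 (by linarith)
  simp only [Lmetric, Matrix.of_apply]
  rw [hev.fderiv_eq]
  have hS := hasFDerivAt_s g hgs z hz
  have hinv := (hasDerivAt_inv hpos.ne').comp_hasFDerivAt z hS
  have h := (((hS.add (hasFDerivAt_linForm A z)).const_mul 2)).mul
    (((hasFDerivAt_linForm (g b) z).mul hinv).const_sub (A b))
  have h' := h.fderiv
  simp only [Pi.mul_def, Pi.add_apply, Function.comp_def] at h'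
  rw [h']
  rw [← hs] at hpos
  simp [linCLM_apply, linForm_single, ← hs]
  rw [hgs.apply a b]
  field_simp
  ring

lemma det_rank_two (c : ℝ) (p q Y v : Fin 4 → ℝ) :
    (Matrix.of fun i j : Fin 4 => c * (1 : Matrix (Fin 4) (Fin 4) ℝ) i j + p i * Y j + q i * v j).det
      = c ^ 2 * ((c + Y ⬝ᵥ p) * (c + v ⬝ᵥ q) - (Y ⬝ᵥ q) * (v ⬝ᵥ p)) := by
  have e : ∀ N : Matrix (Fin 4) (Fin 4) ℝ, N.det =
      N 0 0 * (N.submatrix ![1, 2, 3] ![1, 2, 3]).det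
      - N 0 1 * (N.submatrix ![1, 2, 3] ![0, 2, 3]).det
      + N 0 2 * (N.submatrix ![1, 2, 3] ![0, 1, 3]).det
      - N 0 3 * (N.submatrix ![1, 2, 3] ![0, 1, 2]).det := by
    intro N
    have r : (Fin.succ : Fin 3 → Fin 4) = ![1, 2, 3] := by decide
    have r0 : (Fin.succAbove 0 : Fin 3 → Fin 4) = ![1, 2, 3] := by decide
    have r1 : (Fin.succAbove 1 : Fin 3 → Fin 4) = ![0, 2, 3] := by decide
    have r2 : (Fin.succAbove 2 : Fin 3 → Fin 4) = ![0, 1, 3] := by decide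
    have r3 : (Fin.succAbove 3 : Fin 3 → Fin 4) = ![0, 1, 2] := by decide
    rw [Matrix.det_succ_row_zero, Fin.sum_univ_four, r, r0, r1, r2, r3]
    norm_num [Fin.val_zero, Fin.val_one, Fin.val_two]
    ring
  rw [e]
  simp only [Matrix.det_fin_three, Matrix.submatrix_apply, Matrix.of_apply, dotProduct,
    Fin.sum_univ_four, Matrix.one_apply, Matrix.cons_val]
  simp only [Fin.reduceEq, if_true, if_false]
  ring

lemma det_alg (g : Matrix (Fin 4) (Fin 4) ℝ) (hgs : g.IsSymm) (hgdet : g.det ≠ 0)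
    (A y : Fin 4 → ℝ) (s : ℝ) (hs : 0 < s) (hsq : s ^ 2 = - quadForm g y)
    (M : Matrix (Fin 4) (Fin 4) ℝ)
    (hM : ∀ a b, M a b = (A a - linForm (g a) y / s) * (A b - linForm (g b) y / s)
      + (s + linForm A y) * (- g a b / s - linForm (g a) y * linForm (g b) y / s ^ 3)) :
    M.det = g.det * ((s + linForm A y) / s) ^ 5 := by
  obtain ⟨β, hβ⟩ : ∃ β, g.mulVec β = A :=
    ⟨g⁻¹.mulVec A, by rw [Matrix.mulVec_mulVec, Matrix.mul_nonsing_inv _ (isUnit_iff_ne_zero.2 hgdet),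
      Matrix.one_mulVec]⟩
  set F := s + linForm A y with hF
  set Y := g.mulVec y with hYd
  have hY : ∀ a, linForm (g a) y = Y a := fun a => rfl
  have hMg : M = g * (Matrix.of fun i j : Fin 4 => (-F / s) * (1 : Matrix (Fin 4) (Fin 4) ℝ) i j
      + (-(F / s ^ 3) * y i) * Y j + (β i - y i / s) * (A j - Y j / s)) := by
    ext i j
    have e1 : (Matrix.of fun i j : Fin 4 => (-F / s) * (1 : Matrix (Fin 4) (Fin 4) ℝ) i j
      + (-(F / s ^ 3) * y i) * Y j + (β i - y i / s) * (A j - Y j / s)) =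
      (-F / s) • (1 : Matrix (Fin 4) (Fin 4) ℝ) + Matrix.vecMulVec ((-(F / s ^ 3)) • y) Y
        + Matrix.vecMulVec (β - s⁻¹ • y) (A - s⁻¹ • Y) := by
      ext i j
      simp [Matrix.vecMulVec_apply]
      ring
    rw [e1, Matrix.mul_add, Matrix.mul_add, Matrix.mul_vecMulVec, Matrix.mul_vecMulVec,
      Matrix.mulVec_sub, Matrix.mulVec_smul, Matrix.mulVec_smul, hβ, ← hYd, hM, hY, hY]
    simp [Matrix.vecMulVec_apply]
    ring
  have hYy : Y ⬝ᵥ y = - s ^ 2 := by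
    rw [hsq, quadForm_eq, neg_neg]; rfl
  have hAy : A ⬝ᵥ y = F - s := by rw [hF]; simp [linForm, dotProduct]
  have hYβ : Y ⬝ᵥ β = F - s := by
    rw [← hAy, ← hβ, hYd, dotProduct_comm, Matrix.dotProduct_mulVec, ← Matrix.mulVec_transpose, hgs.eq]
  rw [hMg, Matrix.det_mul]
  have hd := det_rank_two (-F / s) ((-(F / s ^ 3)) • y) (β - s⁻¹ • y) Y (A - s⁻¹ • Y)
  have e2 : (Matrix.of fun i j : Fin 4 => (-F / s) * (1 : Matrix (Fin 4) (Fin 4) ℝ) i j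
      + (-(F / s ^ 3) * y i) * Y j + (β i - y i / s) * (A j - Y j / s)) =
      (Matrix.of fun i j : Fin 4 => (-F / s) * (1 : Matrix (Fin 4) (Fin 4) ℝ) i j
      + ((-(F / s ^ 3)) • y) i * Y j + (β - s⁻¹ • y) i * (A - s⁻¹ • Y) j) := by
    ext i j
    simp
    ring
  rw [e2, hd]
  simp only [dotProduct_sub, sub_dotProduct, dotProduct_smul, smul_dotProduct, smul_eq_mul, hYy,
    hAy, hYβ]
  congr 1
  generalize A ⬝ᵥ β = t
  field_simp
  ring

end Helpers

/-- Determinant of the L-metric of the Randers Lagrangian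
`L = (√(−g(y,y)) + A(y))²` on the set of `g`-spacelike vectors: with `G = g(y,y)` and
`a = A(y)`,
`det g^L = det g · [1 + (5a²/G²)(a² − 2G) + (a/(−G)^{5/2})((a² − 5G)² − 20G²)]`. -/
theorem randers_det_spacelike (g : Matrix (Fin 4) (Fin 4) ℝ) (hgs : g.IsSymm)
    (hgdet : g.det ≠ 0) (A : Fin 4 → ℝ) (L : (Fin 4 → ℝ) → ℝ)
    (hLdef : ∀ y : Fin 4 → ℝ, quadForm g y < 0 →
      L y = (Real.sqrt (-(quadForm g y)) + linForm A y) ^ 2) :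
    ∀ y : Fin 4 → ℝ, quadForm g y < 0 →
      (Lmetric L y).det =
        g.det * (1 + (5 * (linForm A y) ^ 2 / (quadForm g y) ^ 2) *
            ((linForm A y) ^ 2 - 2 * quadForm g y) +
          (linForm A y / (-(quadForm g y)) ^ ((5 : ℝ) / 2)) *
            (((linForm A y) ^ 2 - 5 * quadForm g y) ^ 2 - 20 * (quadForm g y) ^ 2)) := by
  intro y hy
  have hs : 0 < Real.sqrt (-(quadForm g y)) := Real.sqrt_pos.2 (by linarith)
  have hsq : Real.sqrt (-(quadForm g y)) ^ 2 = -quadForm g y := Real.sq_sqrt (by linarith)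
  rw [det_alg g hgs hgdet A y _ hs hsq _
    (fun a b => Lmetric_eq g hgs A L hLdef y hy _ rfl a b)]
  have hp : (-(quadForm g y)) ^ ((5 : ℝ) / 2) = Real.sqrt (-(quadForm g y)) ^ 5 := by
    rw [Real.sqrt_eq_rpow, ← Real.rpow_natCast, ← Real.rpow_mul (by linarith)]
    norm_num
  rw [hp]
  generalize Real.sqrt (-(quadForm g y)) = s at *
  have hG : quadForm g y = - s ^ 2 := by linarith
  rw [hG]
  congr 1
  field_simp
  ring
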